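/- Let p, n ∈ ℕ, a ∈ ℝ, g ∈ ℝⁿ, w ∈ ℝᵖ, ζ₀ ∈ ℝ^{p×n}, let P ∈ ℝ^{p×p} be symmetric positive definite, let Q ∈ ℝ^{n×n} be symmetric positive semidefinite with positive semidefinite square root Q^{1/2}, and let η > 0. If the symmetric (1+p+n)×(1+p+n) block matrix [[a + g·(ζ₀ᵀw), η(Pw)ᵀ, (Q^{1/2}g)ᵀ], [ηPw, −2ηI, 0], [Q^{1/2}g, 0, −2ηI]] is negative semidefinite, then for every Y ∈ ℝ^{p×n} with YᵀY ⪯ I and ζ := ζ₀ + PYQ^{1/2}, one has a + g·(ζᵀw) ≤ 0. -/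

import Mathlib

open Matrix

/-- Completing the square: `u · z ≤ (η / 2) |u|² + |z|² / (2η)`. -/
lemma dotProduct_le_weighted_squares {ι : Type*} [Fintype ι] (u z : ι → ℝ) {η : ℝ} (hη : 0 < η) :
    u ⬝ᵥ z ≤ η / 2 * (u ⬝ᵥ u) + (2 * η)⁻¹ * (z ⬝ᵥ z) := by
  simp only [dotProduct, Finset.mul_sum, ← Finset.sum_add_distrib]
  refine Finset.sum_le_sum fun i _ => ?_
  have h : η / 2 * (u i * u i) + (2 * η)⁻¹ * (z i * z i) - u i * z i
      = (2 * η)⁻¹ * (η * u i - z i) ^ 2 := by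
    field_simp
    ring
  have : 0 ≤ (2 * η)⁻¹ * (η * u i - z i) ^ 2 := by positivity
  linarith

/-- A matrix `Y` with `YᵀY ⪯ I` does not increase Euclidean length. -/
lemma mulVec_dotProduct_self_le {m n : Type*} [Fintype m] [Fintype n] [DecidableEq n]
    {Y : Matrix m n ℝ} (hY : ((1 : Matrix n n ℝ) - Yᵀ * Y).PosSemidef) (v : n → ℝ) :
    (Y *ᵥ v) ⬝ᵥ (Y *ᵥ v) ≤ v ⬝ᵥ v := by
  have h := hY.dotProduct_mulVec_nonneg v
  rw [star_trivial, sub_mulVec, one_mulVec, dotProduct_sub, ← mulVec_mulVec,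
    dotProduct_mulVec v, vecMul_transpose] at h
  linarith

/-- The Schur complement bound obtained from negative semidefiniteness of the block matrix
`[[c, ηuᵀ, vᵀ], [ηu, −2ηI, 0], [v, 0, −2ηI]]`. -/
lemma schur_bound_of_block_negSemidef {m n : Type*} [Fintype m] [Fintype n]
    [DecidableEq m] [DecidableEq n] {c η : ℝ} (hη : 0 < η) {u : m → ℝ} {v : n → ℝ}
    (hM : (-(fromBlocks (of fun (_ _ : Fin 1) => c)
        (fromCols (of fun (_ : Fin 1) j => η * u j) (of fun (_ : Fin 1) j => v j))
        (fromRows (of fun i (_ : Fin 1) => η * u i) (of fun i (_ : Fin 1) => v i))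
        (fromBlocks ((-(2 * η)) • (1 : Matrix m m ℝ)) 0
          0 ((-(2 * η)) • (1 : Matrix n n ℝ))))).PosSemidef) :
    c + η / 2 * (u ⬝ᵥ u) + (2 * η)⁻¹ * (v ⬝ᵥ v) ≤ 0 := by
  have h := hM.dotProduct_mulVec_nonneg
    (Sum.elim (fun _ => 1) (Sum.elim ((1 / 2 : ℝ) • u) ((2 * η)⁻¹ • v)))
  have hu : (of fun (_ : Fin 1) j => η * u j) *ᵥ ((1 / 2 : ℝ) • u)
      = fun _ => η / 2 * (u ⬝ᵥ u) := by
    ext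
    simp only [mulVec, dotProduct, of_apply, Pi.smul_apply, smul_eq_mul, Finset.mul_sum]
    exact Finset.sum_congr rfl fun _ _ => by ring
  have hv : (of fun (_ : Fin 1) j => v j) *ᵥ ((2 * η)⁻¹ • v)
      = fun _ => (2 * η)⁻¹ * (v ⬝ᵥ v) := by
    rw [mulVec_smul]
    rfl
  have hu' : (of fun i (_ : Fin 1) => η * u i) *ᵥ (fun _ => (1 : ℝ)) = η • u := by
    ext
    simp [mulVec, dotProduct]
  have hv' : (of fun i (_ : Fin 1) => v i) *ᵥ (fun _ => (1 : ℝ)) = v := by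
    ext
    simp [mulVec, dotProduct]
  have hc : (of fun (_ _ : Fin 1) => c) *ᵥ (fun _ => (1 : ℝ)) = fun _ => c := by
    ext
    simp [mulVec, dotProduct]
  rw [star_trivial, neg_mulVec, dotProduct_neg, fromBlocks_mulVec, Sum.elim_comp_inl,
    Sum.elim_comp_inr, fromCols_mulVec, fromRows_mulVec, fromBlocks_mulVec, Sum.elim_comp_inl,
    Sum.elim_comp_inr, hu, hv, hu', hv', hc, ← Sum.elim_add_add, sumElim_dotProduct_sumElim,
    sumElim_dotProduct_sumElim] at h
  simp only [smul_mulVec, one_mulVec, zero_mulVec, add_zero, zero_add, dotProduct_add,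
    smul_dotProduct, dotProduct_smul, smul_eq_mul] at h
  simp only [dotProduct, Finset.univ_unique, Finset.sum_singleton, one_mul] at h ⊢
  field_simp at h ⊢
  linarith

/-- If the block matrix `[[a + g·(ζ₀ᵀw), η(Pw)ᵀ, (Q^{1/2}g)ᵀ], [ηPw, −2ηI, 0], [Q^{1/2}g, 0, −2ηI]]`
is negative semidefinite, then `a + g·(ζᵀw) ≤ 0` for every `ζ = ζ₀ + PYQ^{1/2}` with `YᵀY ⪯ I`. -/
theorem block_negSemidef_implies_ellipsoid_bound (p n : ℕ) (a : ℝ)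
    (g : Fin n → ℝ) (w : Fin p → ℝ) (ζ₀ : Matrix (Fin p) (Fin n) ℝ)
    (P : Matrix (Fin p) (Fin p) ℝ) (hP : P.PosDef)
    (Q : Matrix (Fin n) (Fin n) ℝ) (hQ : Q.PosSemidef)
    (Qhalf : Matrix (Fin n) (Fin n) ℝ) (hQhalf : Qhalf.PosSemidef)
    (hQhalfsq : Qhalf * Qhalf = Q)
    (η : ℝ) (hη : 0 < η)
    (hM : (-(Matrix.fromBlocks
        (Matrix.of fun (_ _ : Fin 1) => a + g ⬝ᵥ ζ₀ᵀ.mulVec w)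
        (Matrix.fromCols (Matrix.of fun (_ : Fin 1) j => η * P.mulVec w j)
          (Matrix.of fun (_ : Fin 1) j => Qhalf.mulVec g j))
        (Matrix.fromRows (Matrix.of fun i (_ : Fin 1) => η * P.mulVec w i)
          (Matrix.of fun i (_ : Fin 1) => Qhalf.mulVec g i))
        (Matrix.fromBlocks ((-(2 * η)) • (1 : Matrix (Fin p) (Fin p) ℝ)) 0
          0 ((-(2 * η)) • (1 : Matrix (Fin n) (Fin n) ℝ))))).PosSemidef) :
    ∀ Y : Matrix (Fin p) (Fin n) ℝ,
      ((1 : Matrix (Fin n) (Fin n) ℝ) - Yᵀ * Y).PosSemidef →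
      a + g ⬝ᵥ (ζ₀ + P * Y * Qhalf)ᵀ.mulVec w ≤ 0 := by
  intro Y hY
  have hschur := schur_bound_of_block_negSemidef hη hM
  have hcs := dotProduct_le_weighted_squares (P *ᵥ w) (Y *ᵥ (Qhalf *ᵥ g)) hη
  have hlen := mul_le_mul_of_nonneg_left (mulVec_dotProduct_self_le hY (Qhalf *ᵥ g))
    (by positivity : 0 ≤ (2 * η)⁻¹)
  have hPt : Pᵀ = P := hP.isHermitian
  have hpert : g ⬝ᵥ (P * Y * Qhalf)ᵀ *ᵥ w = (P *ᵥ w) ⬝ᵥ (Y *ᵥ (Qhalf *ᵥ g)) := by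
    rw [dotProduct_mulVec, vecMul_transpose, dotProduct_comm, ← mulVec_mulVec, ← mulVec_mulVec,
      dotProduct_mulVec, ← mulVec_transpose, hPt]
  rw [transpose_add, add_mulVec, dotProduct_add, hpert]
  linarith
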